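/- Assume k ≥ 4, and let S be the set of all x ∈ F that have a base-b expansion (with digits in A) that is totally de Bruijn. Then dim_H(S) ≥ α_k·δ > 0, where δ = log k / log b is the Hausdorff dimension of F and α_k = log((k−2)!)/(k·log k). -/

import Mathlib

/-- The real number in `[0,1]` whose base-`b` digit sequence is `ω` (so that
`ω 0` is the first digit after the point). -/
noncomputable def baseVal (b : ℕ) (ω : ℕ → ℕ) : ℝ :=
  ∑' i : ℕ, (ω i : ℝ) / (b : ℝ) ^ (i + 1)

/-- The initial segment of `ω` of length `A.card ^ n + n - 1` is a (non-cyclic)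
de Bruijn sequence of order `n` in the alphabet `A`: every word of length `n`
over `A` occurs exactly once as a consecutive substring of that initial segment. -/
def dbPrefix (A : Finset ℕ) (n : ℕ) (ω : ℕ → ℕ) : Prop :=
  ∀ v : ℕ → ℕ, (∀ i < n, v i ∈ A) →
    ∃! j : ℕ, j + n ≤ A.card ^ n + n - 1 ∧ ∀ i < n, ω (j + i) = v i

/-- `B_ω`, the set of orders `n ≥ 1` for which the corresponding initial segment of `ω`
is a de Bruijn sequence of order `n`. -/
def deBruijnSet (A : Finset ℕ) (ω : ℕ → ℕ) : Set ℕ :=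
  {n | 0 < n ∧ dbPrefix A n ω}

/-- `ω` is uniformly de Bruijn: `B_ω` is infinite with bounded gap sizes. -/
def UniformlyDeBruijn (A : Finset ℕ) (ω : ℕ → ℕ) : Prop :=
  ∃ g : ℕ, ∀ N : ℕ, ∃ n ∈ deBruijnSet A ω, N < n ∧ n ≤ N + g

/-- `ω` is infinitely de Bruijn: `B_ω` is infinite. -/
def InfinitelyDeBruijn (A : Finset ℕ) (ω : ℕ → ℕ) : Prop :=
  (deBruijnSet A ω).Infinite

/-- `ω` is totally de Bruijn: `B_ω` contains every `n ≥ 1`. -/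
def TotallyDeBruijn (A : Finset ℕ) (ω : ℕ → ℕ) : Prop :=
  ∀ n : ℕ, 0 < n → dbPrefix A n ω

/-- The limit set `F` of the base-`b` IFS with digit alphabet `A`: all reals having at
least one base-`b` expansion with all digits in `A`. -/
def limitSet (b : ℕ) (A : Finset ℕ) : Set ℝ :=
  {x | ∃ ω : ℕ → ℕ, (∀ i, ω i ∈ A) ∧ x = baseVal b ω}

open Finset in
theorem notStuck {V E : Type*} [Fintype V] [Fintype E] [DecidableEq V] [DecidableEq E]
    (src tgt : E → V) (k : ℕ)
    (hout : ∀ v, (univ.filter (fun e => src e = v)).card = k)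
    (hin : ∀ v, (univ.filter (fun e => tgt e = v)).card = k)
    (e : ℕ → E) (x : ℕ → V) (J : ℕ)
    (hs : ∀ j, src (e j) = x j) (ht : ∀ j, tgt (e j) = x (j + 1))
    (hinj : ∀ i < J, ∀ j < J, e i = e j → i = j)
    (τ : V → E) (rank : V → ℕ)
    (hτ : ∀ v, v ≠ x 0 → src (τ v) = v ∧ rank (tgt (τ v)) < rank v)
    (hc : ∀ v, v ≠ x 0 → (∃ j < J, e j = τ v) → ∀ f, src f = v → ∃ j < J, e j = f)
    (hstuck : ∀ f, src f = x J → ∃ j < J, e j = f) :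
    ∀ f, ∃ j < J, e j = f := by
  classical
  -- exits and entries
  have hexitE : ∀ v, ((range J).filter (fun j => x j = v)).card
      = ((univ.filter (fun f => src f = v)).filter (fun f => ∃ j < J, e j = f)).card := by
    intro v
    refine card_bij (fun j _ => e j) ?_ ?_ ?_
    · intro j hj
      simp only [mem_filter, mem_range, mem_univ, true_and] at hj ⊢
      exact ⟨by rw [hs, hj.2], j, hj.1, rfl⟩
    · intro i hi j hj h
      simp only [mem_filter, mem_range] at hi hj
      exact hinj i hi.1 j hj.1 h
    · intro f hf
      simp only [mem_filter, mem_univ, true_and] at hf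
      obtain ⟨h1, j, hj, rfl⟩ := hf
      exact ⟨j, by simp [hj, ← hs, h1], rfl⟩
  have hentryE : ∀ v, ((range J).filter (fun j => x (j+1) = v)).card
      = ((univ.filter (fun f => tgt f = v)).filter (fun f => ∃ j < J, e j = f)).card := by
    intro v
    refine card_bij (fun j _ => e j) ?_ ?_ ?_
    · intro j hj
      simp only [mem_filter, mem_range, mem_univ, true_and] at hj ⊢
      exact ⟨by rw [ht, hj.2], j, hj.1, rfl⟩
    · intro i hi j hj h
      simp only [mem_filter, mem_range] at hi hj
      exact hinj i hi.1 j hj.1 h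
    · intro f hf
      simp only [mem_filter, mem_univ, true_and] at hf
      obtain ⟨h1, j, hj, rfl⟩ := hf
      exact ⟨j, by simp [hj, ← ht, h1], rfl⟩
  have hbal : ∀ v, ((range J).filter (fun j => x (j+1) = v)).card + (if x 0 = v then 1 else 0)
      = ((range J).filter (fun j => x j = v)).card + (if x J = v then 1 else 0) := by
    intro v
    simp only [card_filter]
    rw [← sum_range_succ' (fun j => if x j = v then 1 else 0) J, sum_range_succ]
  have hfull_exit : ∀ v, (∀ f, src f = v → ∃ j < J, e j = f) →
      ((range J).filter (fun j => x j = v)).card = k := by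
    intro v h
    rw [hexitE, filter_true_of_mem, hout]
    intro f hf
    exact h f (by simpa using hf)
  have hentry_le : ∀ v, ((range J).filter (fun j => x (j+1) = v)).card ≤ k := by
    intro v
    rw [hentryE, ← hin v]
    exact card_filter_le _ _
  have hroot : x J = x 0 := by
    by_contra hne
    have h1 := hfull_exit _ hstuck
    have h2 := hbal (x J)
    have h3 := hentry_le (x J)
    rw [if_neg (Ne.symm hne), if_pos rfl] at h2
    omega
  have heq : ∀ v, ((range J).filter (fun j => x (j+1) = v)).card
      = ((range J).filter (fun j => x j = v)).card := by
    intro v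
    have := hbal v
    rw [hroot] at this
    omega
  have key : ∀ n, ∀ v, rank v = n → ∀ f, src f = v → ∃ j < J, e j = f := by
    intro n
    induction n using Nat.strong_induction_on with
    | _ n ih =>
      intro v hv
      by_cases hv0 : v = x 0
      · rw [hv0, ← hroot]; exact hstuck
      · obtain ⟨h1, h2⟩ := hτ v hv0
        apply hc v hv0
        have h3 := hfull_exit _ (ih _ (hv ▸ h2) (tgt (τ v)) rfl)
        rw [← heq, hentryE] at h3
        have h4 := Finset.eq_of_subset_of_card_le
          (filter_subset (fun f => ∃ j < J, e j = f) (univ.filter (fun f => tgt f = tgt (τ v))))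
          (by rw [h3, hin])
        have h5 : τ v ∈ univ.filter (fun f => tgt f = tgt (τ v)) := by simp
        rw [← h4] at h5
        exact (mem_filter.1 h5).2
  intro f
  exact key _ _ rfl f rfl

open Finset in
theorem treeExists {V E : Type*} [Fintype V] [Fintype E] [DecidableEq V] [DecidableEq E]
    (src tgt : E → V) (k : ℕ)
    (hout : ∀ v, (univ.filter (fun e => src e = v)).card = k)
    (hin : ∀ v, (univ.filter (fun e => tgt e = v)).card = k)
    (e : ℕ → E) (x : ℕ → V) (N : ℕ) (hN : N + 1 = Fintype.card V)
    (hs : ∀ j, src (e j) = x j) (ht : ∀ j, tgt (e j) = x (j + 1))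
    (hinj : ∀ i < N + 1, ∀ j < N + 1, x i = x j → i = j)
    (hconn : ∀ R : Set V, x 0 ∈ R → 
      (∀ f, (∀ j < N, e j ≠ f) → (src f ∈ R ↔ tgt f ∈ R)) → ∀ v, v ∈ R) :
    ∃ τ : V → E, ∃ rank : V → ℕ, ∀ v, v ≠ x 0 →
      src (τ v) = v ∧ rank (tgt (τ v)) < rank v ∧ ∀ j < N, e j ≠ τ v := by
  classical
  obtain ⟨RR, hRR0, hRR⟩ : ∃ RR : ℕ → Set V, (∀ v, v ∈ RR 0 ↔ v = x 0) ∧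
      ∀ m v, v ∈ RR (m + 1) ↔ ∃ f, src f = v ∧ tgt f ∈ RR m ∧ ∀ j < N, e j ≠ f :=
    ⟨fun m => Nat.rec {x 0}
      (fun _ S => {v | ∃ f, src f = v ∧ tgt f ∈ S ∧ ∀ j < N, e j ≠ f}) m,
      fun _ => Iff.rfl, fun _ _ => Iff.rfl⟩
  obtain ⟨R, hR⟩ : ∃ R : Set V, ∀ v, v ∈ R ↔ ∃ m, v ∈ RR m := ⟨{v | ∃ m, v ∈ RR m}, fun _ => Iff.rfl⟩
  have h0 : x 0 ∈ R := (hR _).2 ⟨0, (hRR0 _).2 rfl⟩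
  have hpred : ∀ f, (∀ j < N, e j ≠ f) → tgt f ∈ R → src f ∈ R := by
    intro f hf h
    obtain ⟨m, hm⟩ := (hR _).1 h
    exact (hR _).2 ⟨m + 1, (hRR _ _).2 ⟨f, rfl, hm, hf⟩⟩
  have hxbij : ((range (N+1)).filter (fun j => x j ∈ R)).card
      = (univ.filter (fun v : V => v ∈ R)).card := by
    have himg : (range (N+1)).image x = univ := by
      apply eq_univ_of_card
      rw [card_image_of_injOn, card_range, hN]
      intro i hi j hj h
      simp only [coe_range, Set.mem_Iio] at hi hj
      exact hinj i hi j hj h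
    have h2 : univ.filter (fun v : V => v ∈ R) = ((range (N+1)).filter (fun j => x j ∈ R)).image x := by
      rw [← himg, filter_image]
    rw [h2, card_image_of_injOn]
    intro i hi j hj h
    simp only [coe_filter, mem_range, Set.mem_ofPred_eq] at hi hj
    exact hinj i hi.1 j hj.1 h
  have heinj : ∀ i < N, ∀ j < N, e i = e j → i = j := by
    intro i hi j hj h
    exact hinj i (by omega) j (by omega) (by rw [← hs, ← hs, h])
  have cnt : ∀ (g : E → V), (∀ v, (univ.filter (fun e => g e = v)).card = k) →
      (univ.filter (fun f => g f ∈ R ∧ ∀ j < N, e j ≠ f)).card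
        + ((range N).filter (fun j => g (e j) ∈ R)).card = k * (univ.filter (fun v : V => v ∈ R)).card := by
    intro g hg
    have h1 : (univ.filter (fun f => g f ∈ R)).card = k * (univ.filter (fun v : V => v ∈ R)).card := by
      rw [card_eq_sum_card_fiberwise (f := g) (t := univ.filter (fun v : V => v ∈ R))]
      · rw [mul_comm, ← smul_eq_mul, ← sum_const]
        apply sum_congr rfl
        intro v hv
        rw [← hg v]
        congr 1
        ext f
        simp only [mem_filter, mem_univ, true_and] at hv ⊢
        constructor
        · exact fun h => h.2
        · exact fun h => ⟨h ▸ hv, h⟩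
      · intro f hf
        simpa using hf
    have h2 : ((range N).filter (fun j => g (e j) ∈ R)).card
        = ((univ.filter (fun f => g f ∈ R)).filter (fun f => ¬ ∀ j < N, e j ≠ f)).card := by
      refine card_bij (fun j _ => e j) ?_ ?_ ?_
      · intro j hj
        simp only [mem_filter, mem_range, mem_univ, true_and] at hj ⊢
        exact ⟨hj.2, fun h => h j hj.1 rfl⟩
      · intro i hi j hj h
        simp only [mem_filter, mem_range] at hi hj
        exact heinj i hi.1 j hj.1 h
      · intro f hf
        simp only [mem_filter, mem_univ, true_and] at hf
        obtain ⟨h1, h2⟩ := hf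
        push Not at h2
        obtain ⟨j, hj, rfl⟩ := h2
        exact ⟨j, by simp [hj, h1], rfl⟩
    rw [← h1, h2, ← filter_filter, card_filter_add_card_filter_not]
  have cs := cnt src hout
  have ct := cnt tgt hin
  simp only [hs] at cs
  simp only [ht] at ct
  have e1 : ((range N).filter (fun j => x j ∈ R)).card + (if x N ∈ R then 1 else 0)
      = (univ.filter (fun v : V => v ∈ R)).card := by
    rw [← hxbij, card_filter, card_filter, sum_range_succ]
  have e2 : ((range N).filter (fun j => x (j+1) ∈ R)).card + 1
      = (univ.filter (fun v : V => v ∈ R)).card := by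
    rw [← hxbij, card_filter, card_filter, sum_range_succ', if_pos h0]
  have hsub : univ.filter (fun f => tgt f ∈ R ∧ ∀ j < N, e j ≠ f) ⊆
      univ.filter (fun f => src f ∈ R ∧ ∀ j < N, e j ≠ f) := by
    intro f hf
    simp only [mem_filter, mem_univ, true_and] at hf ⊢
    exact ⟨hpred f hf.2 hf.1, hf.2⟩
  have hEq := eq_of_subset_of_card_le hsub (by split_ifs at e1 <;> omega)
  have hall : ∀ v, ∃ m, v ∈ RR m := by
    intro v
    rw [← hR]
    revert v
    apply hconn R h0
    intro f hf
    refine ⟨fun h => ?_, hpred f hf⟩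
    have : f ∈ univ.filter (fun f => src f ∈ R ∧ ∀ j < N, e j ≠ f) := by simp [h]; exact hf
    rw [← hEq] at this
    simp only [mem_filter, mem_univ, true_and] at this
    exact this.1
  have hτ : ∀ v, ∃ f, v ≠ x 0 → src f = v ∧ Nat.find (hall (tgt f)) < Nat.find (hall v) ∧
      ∀ j < N, e j ≠ f := by
    intro v
    by_cases hv : v = x 0
    · exact ⟨e 0, fun h => absurd hv h⟩
    · have hm := Nat.find_spec (hall v)
      rcases hmm : Nat.find (hall v) with _ | m
      · rw [hmm] at hm
        exact absurd ((hRR0 _).1 hm) hv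
      · rw [hmm] at hm
        obtain ⟨f, h1, h2, h3⟩ := (hRR _ _).1 hm
        exact ⟨f, fun _ => ⟨h1, Nat.lt_succ_of_le (Nat.find_min' _ h2), h3⟩⟩
  choose τ hτ using hτ
  exact ⟨τ, fun v => Nat.find (hall v), hτ⟩

/-- The window of length `n` at position `j`. -/
def win {α : Type*} (n j : ℕ) (ω : ℕ → α) : Fin n → α := fun i => ω (j + i)

theorem init_win {α : Type*} (n j : ℕ) (ω : ℕ → α) :
    (Fin.init (win (n+1) j ω) : Fin n → α) = win n j ω := rfl

theorem tail_win {α : Type*} (n j : ℕ) (ω : ℕ → α) :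
    (Fin.tail (win (n+1) j ω) : Fin n → α) = win n (j+1) ω := by
  funext i
  simp only [Fin.tail, win, Fin.val_succ]
  congr 1
  omega

theorem snoc_win {α : Type*} (n j : ℕ) (ω : ℕ → α) :
    (Fin.snoc (win n j ω) (ω (j + n)) : Fin (n+1) → α) = win (n+1) j ω := by
  have := Fin.snoc_init_self (α := fun _ => α) (win (n+1) j ω)
  rw [init_win] at this
  exact this

theorem win_congr {α : Type*} {n j : ℕ} {ω ω' : ℕ → α} (h : ∀ i < j + n, ω i = ω' i) :
    win n j ω = win n j ω' := by
  funext i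
  exact h _ (by omega)

open Finset in
theorem card_out {α : Type*} [Fintype α] [DecidableEq α] (n : ℕ) (v : Fin n → α) :
    (univ.filter (fun e : Fin (n+1) → α => (Fin.init e : Fin n → α) = v)).card
      = Fintype.card α := by
  symm
  refine card_bij (fun a _ => (Fin.snoc v a : Fin (n+1) → α)) ?_ ?_ ?_
  · intro a _
    simp
  · intro a _ b _ h
    have := congrFun h (Fin.last n)
    simpa using this
  · intro e he
    simp only [mem_filter, mem_univ, true_and] at he
    exact ⟨e (Fin.last n), mem_univ _, by rw [← he]; exact Fin.snoc_init_self (α := fun _ => α) e⟩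

open Finset in
theorem card_in {α : Type*} [Fintype α] [DecidableEq α] (n : ℕ) (v : Fin n → α) :
    (univ.filter (fun e : Fin (n+1) → α => (Fin.tail e : Fin n → α) = v)).card
      = Fintype.card α := by
  symm
  refine card_bij (fun a _ => (Fin.cons a v : Fin (n+1) → α)) ?_ ?_ ?_
  · intro a _
    simp
  · intro a _ b _ h
    have := congrFun h 0
    simpa using this
  · intro e he
    simp only [mem_filter, mem_univ, true_and] at he
    exact ⟨e 0, mem_univ _, by rw [← he]; exact Fin.cons_self_tail (α := fun _ => α) e⟩

theorem reach_all {α : Type*} (n : ℕ) (R : Set (Fin n → α)) (r : Fin n → α) (hr : r ∈ R)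
    (hcl : ∀ w : Fin (n+1) → α, (Fin.init w : Fin n → α) ∈ R → (Fin.tail w : Fin n → α) ∈ R) :
    ∀ v, v ∈ R := by
  intro v
  rcases Nat.eq_zero_or_pos n with h0 | hn
  · subst h0
    rwa [Subsingleton.elim v r]
  let s : ℕ → α := fun i => if h : i < n then r ⟨i, h⟩ else v ⟨(i - n) % n, Nat.mod_lt _ hn⟩
  have h1 : win n 0 s = r := by
    funext i
    simp [win, s]
  have h2 : win n n s = v := by
    funext i
    simp [win, s, Nat.mod_eq_of_lt i.2]
  have h3 : ∀ j, win n j s ∈ R := by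
    intro j
    induction j with
    | zero => rwa [h1]
    | succ j ih =>
      rw [← tail_win]
      exact hcl _ ih
  rw [← h2]
  exact h3 n

theorem conn_words {α : Type*} [Fintype α] [DecidableEq α] (hk : 3 ≤ Fintype.card α) (n : ℕ)
    (H : Set (Fin (n+1) → α))
    (hsrc : ∀ f ∈ H, ∀ g ∈ H, (Fin.init f : Fin n → α) = Fin.init g → f = g)
    (htgt : ∀ f ∈ H, ∀ g ∈ H, (Fin.tail f : Fin n → α) = Fin.tail g → f = g)
    (R : Set (Fin n → α)) (r : Fin n → α) (hr : r ∈ R)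
    (hcl : ∀ f, f ∉ H → ((Fin.init f : Fin n → α) ∈ R ↔ (Fin.tail f : Fin n → α) ∈ R)) :
    ∀ v, v ∈ R := by
  rcases Nat.eq_zero_or_pos n with h0 | hn
  · subst h0
    intro v
    rwa [Subsingleton.elim v r]
  apply reach_all n R r hr
  intro w hw
  by_cases hwH : w ∈ H
  swap
  · exact (hcl w hwH).1 hw
  have hne : (0 : Fin (n+1)) ≠ Fin.last n := by
    intro h
    have := congrArg Fin.val h
    simp at this
    omega
  obtain ⟨a', ha'⟩ : ∃ a', a' ≠ w 0 := by
    have : Nontrivial α := Fintype.one_lt_card_iff_nontrivial.1 (by omega)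
    exact exists_ne _
  obtain ⟨b1, b2, hb1, hb2, hb12⟩ : ∃ b1 b2, b1 ≠ w (Fin.last n) ∧ b2 ≠ w (Fin.last n) ∧ b1 ≠ b2 := by
    have h : 1 < (Finset.univ.erase (w (Fin.last n))).card := by
      rw [Finset.card_erase_of_mem (Finset.mem_univ _), Finset.card_univ]
      omega
    obtain ⟨b1, h1, b2, h2, h3⟩ := Finset.one_lt_card.1 h
    exact ⟨b1, b2, (Finset.mem_erase.1 h1).1, (Finset.mem_erase.1 h2).1, h3⟩
  -- init does not see the last letter, tail does not see the first
  have hinit : ∀ (u : Fin (n+1) → α) (b : α),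
      (Fin.init (Function.update u (Fin.last n) b) : Fin n → α) = Fin.init u := by
    intro u b
    exact Fin.init_update_last (α := fun _ => α) u b
  have htail : ∀ (u : Fin (n+1) → α) (b : α),
      (Fin.tail (Function.update u 0 b) : Fin n → α) = Fin.tail u := by
    intro u b
    exact Fin.tail_update_zero (α := fun _ => α) u b
  obtain ⟨b', hb', hb'H⟩ : ∃ b', b' ≠ w (Fin.last n) ∧
      Function.update (Function.update w 0 a') (Fin.last n) b' ∉ H := by
    by_contra hcon
    push Not at hcon
    have := hsrc _ (hcon b1 hb1) _ (hcon b2 hb2) (by rw [hinit, hinit])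
    have := congrFun this (Fin.last n)
    simp at this
    exact hb12 this
  have s1 : (Fin.tail (Function.update w (Fin.last n) b') : Fin n → α) ∈ R := by
    rw [← hcl]
    · rwa [hinit]
    · intro h
      have := congrFun (hsrc _ h _ hwH (hinit _ _)) (Fin.last n)
      simp at this
      exact hb' this
  have s2 : (Fin.init (Function.update w 0 a') : Fin n → α) ∈ R := by
    rw [← hinit _ b', hcl _ hb'H, Function.update_comm hne, htail]
    exact s1
  rw [← htail w a', ← hcl]
  · exact s2
  · intro h
    have := congrFun (htgt _ h _ hwH (htail _ _)) 0
    simp at this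
    exact ha' this

/-- Last-exit trees for the trail of order-`n` windows. -/
def TreeGood {α : Type*} [Fintype α] (n : ℕ) (ω : ℕ → α)
    (τ : (Fin n → α) → (Fin (n+1) → α)) : Prop :=
  ∃ rank : (Fin n → α) → ℕ, ∀ v, v ≠ win n 0 ω →
    (Fin.init (τ v) : Fin n → α) = v ∧ rank (Fin.tail (τ v)) < rank v ∧
      ∀ j < Fintype.card α ^ n - 1, win (n+1) j ω ≠ τ v

theorem exists_treeGood {α : Type*} [Fintype α] [DecidableEq α] (hk : 3 ≤ Fintype.card α) (n : ℕ)
    (ω : ℕ → α)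
    (hinj : ∀ i < Fintype.card α ^ n, ∀ j < Fintype.card α ^ n, win n i ω = win n j ω → i = j) :
    ∃ τ, TreeGood n ω τ := by
  have hpos : 0 < Fintype.card α ^ n := Nat.pow_pos (by omega)
  refine treeExists (fun e : Fin (n+1) → α => (Fin.init e : Fin n → α))
    (fun e => (Fin.tail e : Fin n → α)) (Fintype.card α) (card_out n) (card_in n)
    (fun j => win (n+1) j ω) (fun j => win n j ω) (Fintype.card α ^ n - 1) ?_ (fun j => rfl)
    (fun j => tail_win n j ω) ?_ ?_
  · simp; omega
  · rwa [Nat.sub_add_cancel hpos]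
  · intro R h0 hcl
    refine conn_words hk n {f | ∃ j < Fintype.card α ^ n - 1, win (n+1) j ω = f} ?_ ?_ R _ h0 ?_
    · rintro _ ⟨i, hi, rfl⟩ _ ⟨j, hj, rfl⟩ h
      rw [init_win, init_win] at h
      rw [hinj i (by omega) j (by omega) h]
    · rintro _ ⟨i, hi, rfl⟩ _ ⟨j, hj, rfl⟩ h
      rw [tail_win, tail_win] at h
      have := hinj (i+1) (by omega) (j+1) (by omega) h
      have : i = j := by omega
      rw [this]
    · intro f hf
      refine hcl f ?_
      intro j hj h
      exact hf ⟨j, hj, h⟩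

/-- Length of a de Bruijn word of order `n`. -/
def startPos (k n : ℕ) : ℕ := k ^ n + n - 1

/-- Truncation of a sequence. -/
def cut {α : Type*} [Inhabited α] (L : ℕ) (ω : ℕ → α) : ℕ → α :=
  fun i => if i < L then ω i else default

/-- The chosen last-exit tree. -/
noncomputable def tau {α : Type*} [Fintype α] [Inhabited α] (n : ℕ) (ω : ℕ → α) :
    (Fin n → α) → (Fin (n+1) → α) :=
  Classical.epsilon (TreeGood n (cut (startPos (Fintype.card α) n) ω))

open Classical in
/-- Letters whose edge is unused. -/
noncomputable def Unu {α : Type*} [Fintype α] (n L : ℕ) (ω : ℕ → α) : Finset α :=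
  Finset.univ.filter (fun a => ∀ j < L - n,
    win (n+1) j ω ≠ (Fin.snoc (win n (L - n) ω) a : Fin (n+1) → α))

open Classical in
/-- Letters whose edge is unused and is not the last-exit edge. -/
noncomputable def UnuT {α : Type*} [Fintype α] [Inhabited α] (n L : ℕ) (ω : ℕ → α) : Finset α :=
  (Unu n L ω).filter (fun a =>
    (Fin.snoc (win n (L - n) ω) a : Fin (n+1) → α) ≠ tau n ω (win n (L - n) ω))

open Classical in
/-- Allowed next letters. -/
noncomputable def DExt {α : Type*} [Fintype α] [Inhabited α] (n L : ℕ) (ω : ℕ → α) : Finset α :=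
  if (UnuT n L ω).Nonempty then UnuT n L ω else Unu n L ω

/-- The invariant of stage `n` at length `L`. -/
structure DInv {α : Type*} [Fintype α] [Inhabited α] (n L : ℕ) (ω : ℕ → α) : Prop where
  hn : ∀ i < Fintype.card α ^ n, ∀ j < Fintype.card α ^ n, win n i ω = win n j ω → i = j
  he : ∀ i < L - n, ∀ j < L - n, win (n+1) i ω = win (n+1) j ω → i = j
  hc : ∀ v, v ≠ win n 0 ω → (∃ j < L - n, win (n+1) j ω = tau n ω v) →
    ∀ f, (Fin.init f : Fin n → α) = v → ∃ j < L - n, win (n+1) j ω = f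

set_option linter.unusedSectionVars false

section
variable {α : Type*} [Fintype α] [Inhabited α]

theorem card_pow_pos (n : ℕ) : 0 < Fintype.card α ^ n :=
  Nat.pow_pos Fintype.card_pos

theorem tau_good (hk : 3 ≤ Fintype.card α) (n : ℕ) (ω : ℕ → α)
    (hinj : ∀ i < Fintype.card α ^ n, ∀ j < Fintype.card α ^ n, win n i ω = win n j ω → i = j) :
    TreeGood n ω (tau n ω) := by
  classical
  obtain ⟨τ, h⟩ := exists_treeGood hk n ω hinj
  have hp := card_pow_pos (α := α) n
  have heq : TreeGood n (cut (startPos (Fintype.card α) n) ω) = TreeGood n ω := by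
    funext τ
    have hc : ∀ i < Fintype.card α ^ n + n - 1, cut (startPos (Fintype.card α) n) ω i = ω i := by
      intro i hi
      simp [cut, startPos, hi]
    have h0 : win n 0 (cut (startPos (Fintype.card α) n) ω) = win n 0 ω :=
      win_congr (fun i hi => hc i (by omega))
    have h1 : ∀ j < Fintype.card α ^ n - 1,
        win (n+1) j (cut (startPos (Fintype.card α) n) ω) = win (n+1) j ω :=
      fun j hj => win_congr (fun i hi => hc i (by omega))
    unfold TreeGood
    rw [h0]
    apply propext
    refine exists_congr fun rank => forall_congr' fun v => imp_congr_right fun _ =>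
      and_congr_right fun _ => and_congr_right fun _ => forall_congr' fun j =>
        forall_congr' fun hj => ?_
    rw [h1 j hj]
  unfold tau
  rw [heq]
  exact Classical.epsilon_spec ⟨τ, h⟩

theorem DExt_subset (n L : ℕ) (ω : ℕ → α) : DExt n L ω ⊆ Unu n L ω := by
  classical
  unfold DExt
  split_ifs
  · exact Finset.filter_subset _ _
  · exact Finset.Subset.refl _

theorem DExt_nonempty {n L : ℕ} {ω : ℕ → α} (h : (Unu n L ω).Nonempty) : (DExt n L ω).Nonempty := by
  classical
  unfold DExt
  split_ifs with h1
  · exact h1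
  · exact h

theorem DInv.start (hk : 3 ≤ Fintype.card α) (n : ℕ) (ω : ℕ → α)
    (hinj : ∀ i < Fintype.card α ^ n, ∀ j < Fintype.card α ^ n, win n i ω = win n j ω → i = j) :
    DInv n (startPos (Fintype.card α) n) ω := by
  have hp := card_pow_pos (α := α) n
  have hL : startPos (Fintype.card α) n - n = Fintype.card α ^ n - 1 := by
    unfold startPos; omega
  refine ⟨hinj, ?_, ?_⟩
  · rw [hL]
    intro i hi j hj h
    refine hinj i (by omega) j (by omega) ?_
    rw [← init_win, h, init_win]
  · rw [hL]
    obtain ⟨rank, hr⟩ := tau_good hk n ω hinj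
    rintro v hv ⟨j, hj, h⟩
    exact absurd h ((hr v hv).2.2 j hj)

theorem snoc_eq_win {n L : ℕ} (hnL : n ≤ L) (ω : ℕ → α) :
    (Fin.snoc (win n (L - n) ω) (ω L) : Fin (n+1) → α) = win (n+1) (L - n) ω := by
  have := snoc_win n (L - n) ω
  rwa [Nat.sub_add_cancel hnL] at this

theorem DInv.step (hk : 3 ≤ Fintype.card α) {n L : ℕ} {ω : ℕ → α} (h : DInv n L ω) (hnL : n ≤ L) (hω : ω L ∈ DExt n L ω) :
    DInv n (L+1) ω := by
  classical
  have hL : L + 1 - n = (L - n) + 1 := by omega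
  have hsn := snoc_eq_win hnL ω
  have hun : ∀ j < L - n, win (n+1) j ω ≠ win (n+1) (L - n) ω := by
    have := DExt_subset _ _ _ hω
    simp only [Unu, Finset.mem_filter, Finset.mem_univ, true_and] at this
    rwa [hsn] at this
  refine ⟨h.hn, ?_, ?_⟩
  · rw [hL]
    intro i hi j hj hij
    rcases Nat.lt_succ_iff_lt_or_eq.1 hi with hi | rfl <;>
      rcases Nat.lt_succ_iff_lt_or_eq.1 hj with hj | rfl
    · exact h.he i hi j hj hij
    · exact absurd hij (hun i hi)
    · exact absurd hij.symm (hun j hj)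
    · rfl
  · rw [hL]
    rintro v hv ⟨j, hj, hjv⟩ f hf
    rcases Nat.lt_succ_iff_lt_or_eq.1 hj with hj | rfl
    · obtain ⟨j', h1, h2⟩ := h.hc v hv ⟨j, hj, hjv⟩ f hf
      exact ⟨j', by omega, h2⟩
    · -- the last-exit edge is used now
      obtain ⟨rank, hr⟩ := tau_good hk n ω h.hn
      have hvw : v = win n (L - n) ω := by
        rw [← init_win, hjv, (hr v hv).1]
      · subst hvw
        have hT : ¬ (UnuT n L ω).Nonempty := by
          intro hne
          unfold DExt at hω
          rw [if_pos hne] at hω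
          simp only [UnuT, Finset.mem_filter] at hω
          exact hω.2 (by rw [hsn, hjv])
        have hfs : (Fin.snoc (win n (L - n) ω) (f (Fin.last n)) : Fin (n+1) → α) = f := by
          rw [← hf]
          exact Fin.snoc_init_self (α := fun _ => α) f
        by_cases hfu : f (Fin.last n) ∈ Unu n L ω
        · refine ⟨L - n, by omega, ?_⟩
          by_contra hne
          apply hT
          refine ⟨f (Fin.last n), ?_⟩
          simp only [UnuT, Finset.mem_filter]
          refine ⟨hfu, ?_⟩
          rw [hfs, ← hjv]
          exact Ne.symm hne
        · simp only [Unu, Finset.mem_filter, Finset.mem_univ, true_and, hfs] at hfu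
          push Not at hfu
          obtain ⟨j, hj, h2⟩ := hfu
          exact ⟨j, by omega, h2⟩

theorem DInv.unu_nonempty (hk : 3 ≤ Fintype.card α) {n L : ℕ} {ω : ℕ → α} (h : DInv n L ω)
    (hnL : n ≤ L) (hL2 : L < startPos (Fintype.card α) (n+1)) : (Unu n L ω).Nonempty := by
  classical
  by_contra hemp
  rw [Finset.not_nonempty_iff_eq_empty] at hemp
  obtain ⟨rank, hr⟩ := tau_good hk n ω h.hn
  have hall := notStuck (fun e : Fin (n+1) → α => (Fin.init e : Fin n → α))
    (fun e => (Fin.tail e : Fin n → α)) (Fintype.card α) (card_out n) (card_in n)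
    (fun j => win (n+1) j ω) (fun j => win n j ω) (L - n) (fun j => rfl)
    (fun j => tail_win n j ω) h.he (tau n ω) rank
    (fun v hv => ⟨(hr v hv).1, (hr v hv).2.1⟩) h.hc (by
      intro f hf
      have hfs : (Fin.snoc (win n (L - n) ω) (f (Fin.last n)) : Fin (n+1) → α) = f := by
        rw [← hf]
        exact Fin.snoc_init_self (α := fun _ => α) f
      have hfu : f (Fin.last n) ∉ Unu n L ω := by rw [hemp]; simp
      simp only [Unu, Finset.mem_filter, Finset.mem_univ, true_and, hfs] at hfu
      push Not at hfu
      exact hfu)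
  have hcard : Fintype.card (Fin (n+1) → α) ≤ L - n := by
    rw [← Finset.card_univ, ← Finset.card_range (L - n)]
    have : (Finset.univ : Finset (Fin (n+1) → α)) ⊆
        (Finset.range (L - n)).image (fun j => win (n+1) j ω) := by
      intro f _
      obtain ⟨j, hj, hf⟩ := hall f
      exact Finset.mem_image.2 ⟨j, Finset.mem_range.2 hj, hf⟩
    exact (Finset.card_le_card this).trans Finset.card_image_le
  rw [Fintype.card_fun, Fintype.card_fin] at hcard
  unfold startPos at hL2
  omega

theorem DInv.next {n : ℕ} {ω : ℕ → α} (h : DInv n (startPos (Fintype.card α) (n+1)) ω) :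
    ∀ i < Fintype.card α ^ (n+1), ∀ j < Fintype.card α ^ (n+1),
      win (n+1) i ω = win (n+1) j ω → i = j := by
  have hL : startPos (Fintype.card α) (n+1) - n = Fintype.card α ^ (n+1) := by
    unfold startPos; omega
  have := h.he
  rwa [hL] at this

open Classical in
/-- Number of exits from `v` among the first `J` edges. -/
noncomputable def exits (n J : ℕ) (ω : ℕ → α) (v : Fin n → α) : ℕ :=
  ((Finset.range J).filter (fun j => win n j ω = v)).card

theorem unu_card (n L : ℕ) (ω : ℕ → α) :
    Fintype.card α ≤ (Unu n L ω).card + exits n (L - n) ω (win n (L - n) ω) := by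
  classical
  have h1 : Finset.univ \ Unu n L ω ⊆
      ((Finset.range (L - n)).filter (fun j => win n j ω = win n (L - n) ω)).image
        (fun j => ω (j + n)) := by
    intro a ha
    simp only [Unu, Finset.mem_sdiff, Finset.mem_filter, Finset.mem_univ, true_and] at ha
    push Not at ha
    obtain ⟨j, hj, hja⟩ := ha
    rw [Finset.mem_image]
    refine ⟨j, ?_, ?_⟩
    · rw [Finset.mem_filter, Finset.mem_range]
      refine ⟨hj, ?_⟩
      rw [← init_win, hja, Fin.init_snoc]
    · have := congrFun hja (Fin.last n)
      rw [Fin.snoc_last] at this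
      exact this
  have h2 := (Finset.card_le_card h1).trans Finset.card_image_le
  have h3 := Finset.card_sdiff_add_card_eq_card (Finset.subset_univ (Unu n L ω))
  rw [Finset.card_univ] at h3
  unfold exits
  omega

theorem ext_card (n L : ℕ) (ω : ℕ → α) :
    Fintype.card α - 1 - exits n (L - n) ω (win n (L - n) ω) ≤ (DExt n L ω).card := by
  classical
  have h1 := unu_card n L ω
  have h2 : (Unu n L ω).card ≤ (UnuT n L ω).card + 1 := by
    have hle : ((Unu n L ω).filter (fun a => ¬ (Fin.snoc (win n (L - n) ω) a : Fin (n+1) → α)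
        ≠ tau n ω (win n (L - n) ω))).card ≤ 1 := by
      rw [Finset.card_le_one]
      intro a ha b hb
      simp only [Finset.mem_filter, not_not] at ha hb
      have := congrFun (ha.2.trans hb.2.symm) (Fin.last n)
      simpa using this
    have := Finset.card_filter_add_card_filter_not (s := Unu n L ω)
      (fun a => (Fin.snoc (win n (L - n) ω) a : Fin (n+1) → α)
        ≠ tau n ω (win n (L - n) ω))
    unfold UnuT
    omega
  unfold DExt
  split_ifs <;> omega

theorem exits_le {n J : ℕ} {ω : ℕ → α}
    (he : ∀ i < J, ∀ j < J, win (n+1) i ω = win (n+1) j ω → i = j) (v : Fin n → α) :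
    exits n J ω v ≤ Fintype.card α := by
  classical
  unfold exits
  rw [← Finset.card_univ]
  refine Finset.card_le_card_of_injOn (fun j => ω (j + n)) (fun _ _ => Finset.mem_coe.2 (Finset.mem_univ _)) ?_
  intro i hi j hj hij
  simp only [Finset.coe_filter, Finset.mem_range, Set.mem_ofPred_eq] at hi hj
  apply he i hi.1 j hj.1
  rw [← snoc_win, ← snoc_win, hi.2, hj.2]
  simp only at hij
  rw [hij]

theorem exits_succ (n J : ℕ) (ω : ℕ → α) (v : Fin n → α) [Decidable (win n J ω = v)] :
    exits n (J+1) ω v = exits n J ω v + if win n J ω = v then 1 else 0 := by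
  classical
  unfold exits
  rw [Finset.card_filter, Finset.card_filter, Finset.sum_range_succ]
  congr

theorem sum_exits (n J : ℕ) (ω : ℕ → α) : ∑ v, exits n J ω v = J := by
  classical
  unfold exits
  rw [← Finset.card_eq_sum_card_fiberwise (f := fun j => win n j ω) (t := Finset.univ)]
  · simp
  · intro _ _
    simp

theorem exits_start (n : ℕ) (ω : ℕ → α) (J : ℕ)
    (hn : ∀ i < J, ∀ j < J, win n i ω = win n j ω → i = j) (v : Fin n → α) :
    exits n J ω v ≤ 1 := by
  classical
  unfold exits
  rw [Finset.card_le_one]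
  intro i hi j hj
  simp only [Finset.mem_filter, Finset.mem_range] at hi hj
  exact hn i hi.1 j hj.1 (hi.2.trans hj.2.symm)

end

theorem startPos_zero (k : ℕ) : startPos k 0 = 0 := by simp [startPos]

theorem startPos_lt (k : ℕ) (hk : 1 ≤ k) (n : ℕ) : startPos k n < startPos k (n+1) := by
  unfold startPos
  have h1 : 0 < k ^ n := Nat.pow_pos hk
  have : k ^ n ≤ k ^ (n+1) := Nat.pow_le_pow_right hk (by omega)
  omega

theorem startPos_strictMono (k : ℕ) (hk : 1 ≤ k) : StrictMono (startPos k) :=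
  strictMono_nat_of_lt_succ (startPos_lt k hk)

theorem le_startPos (k : ℕ) (hk : 1 ≤ k) (n : ℕ) : n ≤ startPos k n :=
  (startPos_strictMono k hk).le_apply

/-- The stage of a word of length `L`. -/
def stg (k L : ℕ) : ℕ := Nat.findGreatest (fun n => startPos k n ≤ L) L

theorem stg_le (k L : ℕ) : startPos k (stg k L) ≤ L :=
  Nat.findGreatest_spec (P := fun n => startPos k n ≤ L) (Nat.zero_le L)
    (by rw [startPos_zero]; omega)

theorem stg_lt (k L : ℕ) (hk : 1 ≤ k) : L < startPos k (stg k L + 1) := by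
  by_contra h
  push Not at h
  have h1 := le_startPos k hk (stg k L + 1)
  have := Nat.le_findGreatest (P := fun n => startPos k n ≤ L) (h1.trans h) h
  unfold stg at this
  omega

theorem stg_eq (k L n : ℕ) (hk : 1 ≤ k) (h1 : startPos k n ≤ L) (h2 : L < startPos k (n+1)) :
    stg k L = n := by
  have h3 := stg_le k L
  have h4 := stg_lt k L hk
  have hm := startPos_strictMono k hk
  have a1 := hm.lt_iff_lt.1 (lt_of_le_of_lt h1 h4)
  have a2 := hm.lt_iff_lt.1 (lt_of_le_of_lt h3 h2)
  omega

section
variable {α : Type*} [Fintype α] [Inhabited α]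

/-- Allowed next letters, stage computed from the length. -/
noncomputable def EE (L : ℕ) (ω : ℕ → α) : Finset α := DExt (stg (Fintype.card α) L) L ω

theorem EE_congr (L : ℕ) (ω ω' : ℕ → α) (h : ∀ i < L, ω i = ω' i) : EE L ω = EE L ω' := by
  classical
  have hk : 1 ≤ Fintype.card α := Fintype.card_pos
  have h1 := stg_le (Fintype.card α) L
  have h0 := le_startPos (Fintype.card α) hk (stg (Fintype.card α) L)
  unfold EE
  generalize hn : stg (Fintype.card α) L = n at *
  have w0 : win n (L - n) ω = win n (L - n) ω' := win_congr (fun i hi => h i (by omega))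
  have w1 : ∀ j < L - n, win (n+1) j ω = win (n+1) j ω' :=
    fun j hj => win_congr (fun i hi => h i (by omega))
  have hU : Unu n L ω = Unu n L ω' := by
    unfold Unu
    rw [w0]
    apply Finset.filter_congr
    intro a _
    refine forall_congr' fun j => forall_congr' fun hj => ?_
    rw [w1 j hj]
  have hcut : cut (startPos (Fintype.card α) n) ω = cut (startPos (Fintype.card α) n) ω' := by
    funext i
    unfold cut
    split_ifs with hi
    · exact h i (by omega)
    · rfl
  have hτ : tau n ω = tau n ω' := by
    unfold tau
    rw [hcut]
  have hT : UnuT n L ω = UnuT n L ω' := by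
    unfold UnuT
    rw [hU, hτ, w0]
  unfold DExt
  rw [hU, hT]

theorem allowed_inv (hk : 3 ≤ Fintype.card α) (ω : ℕ → α) (L : ℕ)
    (h : ∀ i < L, ω i ∈ EE i ω) : DInv (stg (Fintype.card α) L) L ω := by
  have hk1 : 1 ≤ Fintype.card α := by omega
  induction L with
  | zero =>
    have h0 : stg (Fintype.card α) 0 = 0 := by simp [stg]
    rw [h0]
    have := DInv.start hk 0 ω (by intro i hi j hj _; simp at hi hj; omega)
    rwa [startPos_zero] at this
  | succ L ih =>
    have hI := ih (fun i hi => h i (by omega))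
    have h1 := stg_le (Fintype.card α) L
    have h2 := stg_lt (Fintype.card α) L hk1
    have h0 := le_startPos (Fintype.card α) hk1 (stg (Fintype.card α) L)
    have hS := hI.step hk (by omega) (h L (by omega))
    rcases Nat.lt_or_ge (L+1) (startPos (Fintype.card α) (stg (Fintype.card α) L + 1)) with h3 | h3
    · rw [stg_eq (Fintype.card α) (L+1) (stg (Fintype.card α) L) hk1 (by omega) h3]
      exact hS
    · have h4 : L + 1 = startPos (Fintype.card α) (stg (Fintype.card α) L + 1) := by omega
      rw [stg_eq (Fintype.card α) (L+1) (stg (Fintype.card α) L + 1) hk1 h4.ge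
        (by rw [h4]; exact startPos_lt _ hk1 _)]
      rw [h4] at hS ⊢
      exact DInv.start hk _ ω hS.next

theorem EE_nonempty (hk : 3 ≤ Fintype.card α) (ω : ℕ → α) (L : ℕ)
    (h : ∀ i < L, ω i ∈ EE i ω) : (EE L ω).Nonempty := by
  have hk1 : 1 ≤ Fintype.card α := by omega
  have h1 := stg_le (Fintype.card α) L
  have h0 := le_startPos (Fintype.card α) hk1 (stg (Fintype.card α) L)
  exact DExt_nonempty ((allowed_inv hk ω L h).unu_nonempty hk (by omega) (stg_lt _ _ hk1))

theorem allowed_inj (hk : 3 ≤ Fintype.card α) (ω : ℕ → α) (h : ∀ i, ω i ∈ EE i ω) (n : ℕ) :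
    ∀ i < Fintype.card α ^ n, ∀ j < Fintype.card α ^ n, win n i ω = win n j ω → i = j := by
  have hk1 : 1 ≤ Fintype.card α := by omega
  have := (allowed_inv hk ω (startPos (Fintype.card α) n) (fun i _ => h i)).hn
  rwa [stg_eq _ _ n hk1 le_rfl (startPos_lt _ hk1 _)] at this

theorem avg_antitone (a : ℕ → ℝ) (ha : Antitone a) (M N : ℕ) (h : M ≤ N) :
    (M : ℝ) * ∑ i ∈ Finset.range N, a i ≤ N * ∑ i ∈ Finset.range M, a i := by
  induction N, h using Nat.le_induction with
  | base => exact le_rfl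
  | succ N hN ih =>
    rw [Finset.sum_range_succ]
    push_cast
    have : (M : ℝ) * a N ≤ ∑ i ∈ Finset.range M, a i := by
      have := Finset.card_nsmul_le_sum (Finset.range M) a (a N)
        (fun i hi => ha (by have := Finset.mem_range.1 hi; omega))
      simpa using this
    linarith

/-- The potential. -/
noncomputable def GG (k M : ℕ) : ℝ := ∑ m ∈ Finset.range (M - 1), Real.log ((k - 2 - m : ℕ) : ℝ)

theorem log_nat_mono {a b : ℕ} (h : a ≤ b) : Real.log (a : ℝ) ≤ Real.log (b : ℝ) := by
  rcases Nat.eq_zero_or_pos a with rfl | ha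
  · simpa using Real.log_natCast_nonneg b
  · exact Real.log_le_log (by exact_mod_cast ha) (by exact_mod_cast h)

theorem log_fact_eq (j : ℕ) :
    Real.log (Nat.factorial j) = ∑ m ∈ Finset.range (j+1), Real.log ((j - m : ℕ) : ℝ) := by
  have := Finset.sum_range_reflect (fun m => Real.log ((m : ℕ) : ℝ)) (j+1)
  simp only [Nat.add_sub_cancel] at this
  rw [this]
  clear this
  induction j with
  | zero => simp
  | succ j ih =>
    rw [Finset.sum_range_succ, ← ih, Nat.factorial_succ]
    push_cast
    rw [Real.log_mul (by positivity) (by positivity)]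
    ring

theorem GG_lower (k : ℕ) (hk : 3 ≤ k) (M : ℕ) (hM : M ≤ k) :
    Real.log (Nat.factorial (k-2)) / (k - 1) * ((M : ℝ) - 1) ≤ GG k M := by
  have hk' : (0 : ℝ) < (k : ℝ) - 1 := by
    have : (3 : ℝ) ≤ k := by exact_mod_cast hk
    linarith
  have hc : 0 ≤ Real.log (Nat.factorial (k-2)) := Real.log_natCast_nonneg _
  rcases Nat.eq_zero_or_pos M with rfl | hMp
  · simp only [GG]
    simp
    positivity
  · have := avg_antitone (fun m => Real.log ((k - 2 - m : ℕ) : ℝ))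
      (fun a b h => log_nat_mono (by omega)) (M - 1) (k - 1) (by omega)
    have hf := log_fact_eq (k - 2)
    rw [show k - 2 + 1 = k - 1 by omega] at hf
    rw [← hf] at this
    rw [div_mul_eq_mul_div, div_le_iff₀ hk']
    rw [Nat.cast_sub (by omega), Nat.cast_sub (by omega)] at this
    unfold GG
    push_cast at this ⊢
    linarith

theorem growth_stage (hk : 3 ≤ Fintype.card α) (ω : ℕ → α) (h : ∀ i, ω i ∈ EE i ω) (n L : ℕ)
    (h1 : startPos (Fintype.card α) n ≤ L) (h2 : L ≤ startPos (Fintype.card α) (n+1)) :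
    DInv n L ω ∧ ∑ i ∈ Finset.range (startPos (Fintype.card α) n), Real.log ((EE i ω).card : ℝ)
      + ∑ v, GG (Fintype.card α) (exits n (L - n) ω v)
      ≤ ∑ i ∈ Finset.range L, Real.log ((EE i ω).card : ℝ) := by
  classical
  have hk1 : 1 ≤ Fintype.card α := by omega
  have h0 := le_startPos (Fintype.card α) hk1 n
  induction L, h1 using Nat.le_induction with
  | base =>
    have hp := card_pow_pos (α := α) n
    have hin := allowed_inj hk ω h n
    refine ⟨DInv.start hk n ω hin, ?_⟩
    have hz : ∑ v, GG (Fintype.card α) (exits n (startPos (Fintype.card α) n - n) ω v) = 0 := ?_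
    · rw [hz, add_zero]
    refine Finset.sum_eq_zero ?_
    intro v _
    have h3 := exits_start n ω (startPos (Fintype.card α) n - n) (by
      unfold startPos
      intro i hi j hj
      exact hin i (by omega) j (by omega)) v
    have : exits n (startPos (Fintype.card α) n - n) ω v - 1 = 0 := by omega
    unfold GG
    rw [this]
    simp
  | succ L hL ih =>
    obtain ⟨hI, ih⟩ := ih (by omega)
    have hst := stg_eq (Fintype.card α) L n hk1 hL (by omega)
    have hE : EE L ω = DExt n L ω := by unfold EE; rw [hst]
    refine ⟨hI.step hk (by omega) (hE ▸ h L), ?_⟩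
    rw [Finset.sum_range_succ, show L + 1 - n = (L - n) + 1 by omega]
    have hstep : ∑ v, GG (Fintype.card α) (exits n (L - n + 1) ω v)
        ≤ ∑ v, GG (Fintype.card α) (exits n (L - n) ω v) + Real.log ((EE L ω).card : ℝ) := by
      have hv : ∀ v, GG (Fintype.card α) (exits n (L - n + 1) ω v)
          ≤ GG (Fintype.card α) (exits n (L - n) ω v)
            + if win n (L - n) ω = v then Real.log ((EE L ω).card : ℝ) else 0 := by
        intro v
        rw [exits_succ]
        split_ifs with hv
        · subst hv
          have hc := ext_card n L ω
          rw [hE]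
          rcases Nat.eq_zero_or_pos (exits n (L - n) ω (win n (L - n) ω)) with hz | hz
          · rw [hz]
            simp only [GG]
            simpa using Real.log_natCast_nonneg _
          · obtain ⟨M, hM⟩ := Nat.exists_eq_add_of_lt hz
            rw [hM] at hc ⊢
            simp only [GG, zero_add, Nat.add_sub_cancel]
            rw [Finset.sum_range_succ]
            exact add_le_add le_rfl (log_nat_mono (by omega))
        · simp
      refine (Finset.sum_le_sum (fun v _ => hv v)).trans ?_
      rw [Finset.sum_add_distrib]
      simp
    linarith

theorem growth_stage' (hk : 3 ≤ Fintype.card α) (ω : ℕ → α) (h : ∀ i, ω i ∈ EE i ω) (n L : ℕ)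
    (h1 : startPos (Fintype.card α) n ≤ L) (h2 : L ≤ startPos (Fintype.card α) (n+1)) :
    ∑ i ∈ Finset.range (startPos (Fintype.card α) n), Real.log ((EE i ω).card : ℝ)
      + Real.log (Nat.factorial (Fintype.card α - 2)) / (Fintype.card α - 1) *
        ((L : ℝ) - startPos (Fintype.card α) n - 1)
      ≤ ∑ i ∈ Finset.range L, Real.log ((EE i ω).card : ℝ) := by
  have hk1 : 1 ≤ Fintype.card α := by omega
  have hp := card_pow_pos (α := α) n
  have h0 := le_startPos (Fintype.card α) hk1 n
  obtain ⟨hI, hle⟩ := growth_stage hk ω h n L h1 h2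
  refine le_trans ?_ hle
  gcongr
  have hs : ∑ v, Real.log (Nat.factorial (Fintype.card α - 2)) / (Fintype.card α - 1) *
      (((exits n (L - n) ω v : ℕ) : ℝ) - 1) ≤ ∑ v, GG (Fintype.card α) (exits n (L - n) ω v) :=
    Finset.sum_le_sum (fun v _ => GG_lower _ hk _ (exits_le hI.he v))
  refine le_trans (le_of_eq ?_) hs
  rw [← Finset.mul_sum, Finset.sum_sub_distrib, ← Nat.cast_sum, sum_exits]
  congr 1
  simp only [Finset.sum_const, Finset.card_univ, Fintype.card_fun, Fintype.card_fin, nsmul_eq_mul,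
    mul_one]
  rw [Nat.cast_sub (by omega)]
  unfold startPos
  rw [Nat.cast_sub (by omega)]
  push_cast
  ring

theorem growth (hk : 3 ≤ Fintype.card α) (ω : ℕ → α) (h : ∀ i, ω i ∈ EE i ω) (L : ℕ) :
    Real.log (Nat.factorial (Fintype.card α - 2)) / (Fintype.card α - 1) *
        ((L : ℝ) - stg (Fintype.card α) L - 1)
      ≤ ∑ i ∈ Finset.range L, Real.log ((EE i ω).card : ℝ) := by
  have hk1 : 1 ≤ Fintype.card α := by omega
  have hs : ∀ n, Real.log (Nat.factorial (Fintype.card α - 2)) / (Fintype.card α - 1) *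
        ((startPos (Fintype.card α) n : ℝ) - n)
      ≤ ∑ i ∈ Finset.range (startPos (Fintype.card α) n), Real.log ((EE i ω).card : ℝ) := by
    intro n
    induction n with
    | zero => simp [startPos_zero]
    | succ n ih =>
      have := growth_stage' hk ω h n _ (startPos_lt _ hk1 n).le le_rfl
      push_cast
      linarith
  have := growth_stage' hk ω h (stg (Fintype.card α) L) L (stg_le _ _) (stg_lt _ _ hk1).le
  have := hs (stg (Fintype.card α) L)
  linarith

end

open Classical in
/-- The `i`-th element of a finite set. -/
noncomputable def pick {α : Type*} [Inhabited α] (s : Finset α) (i : ℕ) : α :=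
  if h : i < s.card then (s.equivFin.symm ⟨i, h⟩ : α) else default

theorem pick_mem {α : Type*} [Inhabited α] (s : Finset α) (i : ℕ) (h : i < s.card) :
    pick s i ∈ s := by
  unfold pick
  rw [dif_pos h]
  exact Subtype.coe_prop _

theorem pick_inj {α : Type*} [Inhabited α] (s : Finset α) (i j : ℕ) (hi : i < s.card)
    (hj : j < s.card) (h : pick s i = pick s j) : i = j := by
  unfold pick at h
  rw [dif_pos hi, dif_pos hj] at h
  have := s.equivFin.symm.injective (Subtype.ext h)
  simpa using this

/-- The coding process. -/
noncomputable def codeState {α : Type*} [Inhabited α] (E : ℕ → (ℕ → α) → Finset α) (t : ℝ) :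
    ℕ → (ℕ → α) × ℝ
  | 0 => (fun _ => default, t)
  | L + 1 =>
    (Function.update (codeState E t L).1 L
      (pick (E L (codeState E t L).1) ⌊((E L (codeState E t L).1).card : ℝ) * (codeState E t L).2⌋₊),
      Int.fract (((E L (codeState E t L).1).card : ℝ) * (codeState E t L).2))

theorem coding {α : Type*} [Inhabited α] (E : ℕ → (ℕ → α) → Finset α)
    (hloc : ∀ L ω ω', (∀ i < L, ω i = ω' i) → E L ω = E L ω')
    (hne : ∀ L ω, (∀ i < L, ω i ∈ E i ω) → (E L ω).Nonempty) :
    ∃ Ω : ℝ → ℕ → α, (∀ t ∈ Set.Ico (0:ℝ) 1, ∀ L, Ω t L ∈ E L (Ω t)) ∧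
      ∀ t ∈ Set.Ico (0:ℝ) 1, ∀ t' ∈ Set.Ico (0:ℝ) 1, ∀ L, (∀ i < L, Ω t i = Ω t' i) →
        |t - t'| * ∏ i ∈ Finset.range L, ((E i (Ω t)).card : ℝ) ≤ 1 := by
  let Ω : ℝ → ℕ → α := fun t L => (codeState E t (L+1)).1 L
  have hst : ∀ t L, ∀ i < L, (codeState E t L).1 i = Ω t i := by
    intro t L
    induction L with
    | zero => intro i hi; omega
    | succ L ih =>
      intro i hi
      rcases Nat.lt_succ_iff_lt_or_eq.1 hi with hi | rfl
      · rw [← ih i hi, codeState]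
        simp [Function.update_of_ne hi.ne]
      · rfl
  have hE : ∀ t L, E L (codeState E t L).1 = E L (Ω t) := fun t L => hloc _ _ _ (hst t L)
  have hr0 : ∀ t, (codeState E t 0).2 = t := fun t => rfl
  have hrs : ∀ t L, (codeState E t (L+1)).2
      = Int.fract (((E L (Ω t)).card : ℝ) * (codeState E t L).2) := by
    intro t L
    rw [← hE]
    rfl
  have hΩ : ∀ t L, Ω t L = pick (E L (Ω t)) ⌊((E L (Ω t)).card : ℝ) * (codeState E t L).2⌋₊ := by
    intro t L
    rw [← hE]
    simp [Ω, codeState]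
  have hr : ∀ t ∈ Set.Ico (0:ℝ) 1, ∀ L, (codeState E t L).2 ∈ Set.Ico (0:ℝ) 1 := by
    intro t ht L
    cases L with
    | zero => exact ht
    | succ L =>
      rw [hrs]
      exact ⟨Int.fract_nonneg _, Int.fract_lt_one _⟩
  have hfl : ∀ t ∈ Set.Ico (0:ℝ) 1, ∀ L, (E L (Ω t)).Nonempty →
      ⌊((E L (Ω t)).card : ℝ) * (codeState E t L).2⌋₊ < (E L (Ω t)).card := by
    intro t ht L hn
    have hc : (0:ℝ) < (E L (Ω t)).card := by exact_mod_cast hn.card_pos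
    obtain ⟨h1, h2⟩ := hr t ht L
    rw [Nat.floor_lt (mul_nonneg (Nat.cast_nonneg _) h1)]
    nlinarith
  have hmem : ∀ t ∈ Set.Ico (0:ℝ) 1, ∀ L, Ω t L ∈ E L (Ω t) := by
    intro t ht L
    induction L using Nat.strong_induction_on with
    | _ L ih =>
      rw [hΩ]
      exact pick_mem _ _ (hfl t ht L (hne L _ ih))
  refine ⟨Ω, hmem, ?_⟩
  intro t ht t' ht' L hag
  have key : (codeState E t L).2 - (codeState E t' L).2
      = (t - t') * ∏ i ∈ Finset.range L, ((E i (Ω t)).card : ℝ) := by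
    induction L with
    | zero => simp [hr0]
    | succ L ih =>
      have ih := ih (fun i hi => hag i (by omega))
      have hEE : E L (Ω t) = E L (Ω t') := hloc _ _ _ (fun i hi => hag i (by omega))
      have hN : (E L (Ω t)).Nonempty := ⟨_, hmem t ht L⟩
      have h1 := hfl t ht L hN
      have h2 := hfl t' ht' L (hEE ▸ hN)
      have h3 := hag L (by omega)
      rw [hΩ t L, hΩ t' L] at h3
      rw [← hEE] at h3 h2
      have h4 := pick_inj _ _ _ h1 h2 h3
      have hp := (hr t ht L).1
      have hp' := (hr t' ht' L).1
      rw [hrs, hrs, ← hEE, Finset.prod_range_succ, ← mul_assoc, ← ih]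
      rw [Int.fract, Int.fract, ← natCast_floor_eq_intCast_floor (mul_nonneg (Nat.cast_nonneg _) hp),
        ← natCast_floor_eq_intCast_floor (mul_nonneg (Nat.cast_nonneg _) hp'), h4]
      ring
  have hpos : 0 ≤ ∏ i ∈ Finset.range L, ((E i (Ω t)).card : ℝ) :=
    Finset.prod_nonneg (fun _ _ => Nat.cast_nonneg _)
  rw [← abs_of_nonneg hpos, ← abs_mul, ← key, abs_le]
  have := hr t ht L
  have := hr t' ht' L
  simp only [Set.mem_Ico] at *
  constructor <;> linarith

open scoped NNReal ENNReal in
theorem dim_lower (X : ℝ → ℝ) (C s : ℝ≥0) (hs : 0 < s)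
    (h : ∀ t ∈ Set.Ico (0:ℝ) 1, ∀ t' ∈ Set.Ico (0:ℝ) 1, |t - t'| ≤ C * |X t - X t'| ^ (s:ℝ)) :
    (s : ℝ≥0∞) ≤ dimH (X '' Set.Ico (0:ℝ) 1) := by
  have hinj : Set.InjOn X (Set.Ico (0:ℝ) 1) := by
    intro t ht t' ht' he
    have := h t ht t' ht'
    rw [he, sub_self, abs_zero, Real.zero_rpow (by exact_mod_cast hs.ne'), mul_zero] at this
    have := abs_nonpos_iff.1 this
    linarith
  have hH : HolderOnWith C s (Function.invFunOn X (Set.Ico (0:ℝ) 1)) (X '' Set.Ico (0:ℝ) 1) := by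
    rintro _ ⟨t, ht, rfl⟩ _ ⟨t', ht', rfl⟩
    rw [hinj.leftInvOn_invFunOn ht, hinj.leftInvOn_invFunOn ht']
    rw [edist_dist, edist_dist, Real.dist_eq, Real.dist_eq,
      ENNReal.ofReal_rpow_of_nonneg (abs_nonneg _) s.coe_nonneg, ← ENNReal.ofReal_coe_nnreal,
      ← ENNReal.ofReal_mul C.coe_nonneg]
    exact ENNReal.ofReal_le_ofReal (h t ht t' ht')
  have := hH.dimH_image_le hs
  rw [hinj.invFunOn_image subset_rfl, Real.dimH_of_nonempty_interior (by simp)] at this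
  simp only [Module.finrank_self, Nat.cast_one] at this
  have hs' : (s : ℝ≥0∞) ≠ 0 := by exact_mod_cast hs.ne'
  rw [ENNReal.le_div_iff_mul_le (Or.inl hs') (Or.inl ENNReal.coe_ne_top), one_mul] at this
  exact this

theorem summable_base (b : ℕ) (hb : 2 ≤ b) (ω : ℕ → ℕ) (h : ∀ i, ω i < b) :
    Summable (fun i => (ω i : ℝ) / (b : ℝ) ^ (i+1)) := by
  have hb' : (2:ℝ) ≤ b := by exact_mod_cast hb
  have hg : Summable (fun i : ℕ => ((b:ℝ)⁻¹) ^ i) :=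
    summable_geometric_of_lt_one (by positivity) (inv_lt_one_of_one_lt₀ (by linarith))
  refine Summable.of_nonneg_of_le (fun i => by positivity) (fun i => ?_) hg
  rw [inv_pow, pow_succ, div_le_iff₀ (by positivity)]
  have : (ω i : ℝ) ≤ b := by exact_mod_cast (h i).le
  calc (ω i : ℝ) ≤ b := this
    _ = _ := by field_simp

theorem base_sep (b : ℕ) (hb : 2 ≤ b) (ω ω' : ℕ → ℕ) (h : ∀ i, ω i < b) (h' : ∀ i, ω' i < b)
    (L : ℕ) (hag : ∀ i < L, ω i = ω' i) (hL : ω L < ω' L) (i : ℕ) (hi : L < i)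
    (hωi : ω i ≠ b - 1) :
    1 / (b:ℝ) ^ (i+1) ≤ baseVal b ω' - baseVal b ω := by
  have hb' : (2:ℝ) ≤ b := by exact_mod_cast hb
  have hs := (summable_base b hb ω h).hasSum
  have hs' := (summable_base b hb ω' h').hasSum
  let ψ : ℕ → ℝ := fun j => (if j < L then 0 else if j = L then -1 else (b:ℝ) - 1) / (b:ℝ) ^ (j+1)
  have hψ : HasSum ψ 0 := by
    rw [← hasSum_nat_add_iff' (L+1)]
    have h1 : ∑ j ∈ Finset.range (L+1), ψ j = -1 / (b:ℝ) ^ (L+1) := by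
      rw [Finset.sum_range_succ, Finset.sum_eq_zero, zero_add]
      · simp [ψ]
      · intro j hj
        simp [ψ, Finset.mem_range.1 hj]
    have h2 : (fun j => ψ (j + (L+1))) = fun j => (((b:ℝ) - 1) / (b:ℝ)^(L+2)) * ((b:ℝ)⁻¹) ^ j := by
      funext j
      simp only [ψ]
      rw [if_neg (by omega), if_neg (by omega), inv_pow, ← div_eq_mul_inv, div_div, ← pow_add]
      congr 2
      ring
    rw [h1, h2]
    have hg := hasSum_geometric_of_lt_one (r := (b:ℝ)⁻¹) (by positivity)
      (inv_lt_one_of_one_lt₀ (by linarith))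
    have hg := hg.mul_left (((b:ℝ) - 1) / (b:ℝ)^(L+2))
    have : (b:ℝ) - 1 ≠ 0 := by linarith
    have hb0 : (b:ℝ) ≠ 0 := by linarith
    have h5 : (1 - (b:ℝ)⁻¹) = ((b:ℝ) - 1) / b := by field_simp
    have h6 : (0:ℝ) - -1 / (b:ℝ) ^ (L+1) = (((b:ℝ) - 1) / (b:ℝ)^(L+2)) * (1 - (b:ℝ)⁻¹)⁻¹ := by
      rw [h5]
      field_simp
      ring
    rw [h6]
    exact hg
  have hφ := (hs'.sub hs).add hψ
  rw [add_zero] at hφ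
  have hnn : ∀ j, 0 ≤ (ω' j : ℝ) / (b:ℝ)^(j+1) - (ω j : ℝ) / (b:ℝ)^(j+1) + ψ j := by
    intro j
    simp only [ψ]
    rw [← sub_div, ← add_div]
    apply div_nonneg _ (by positivity)
    split_ifs with c1 c2
    · rw [hag j c1]; simp
    · subst c2
      have : (ω j : ℝ) + 1 ≤ ω' j := by exact_mod_cast hL
      linarith
    · have : (ω j : ℝ) + 1 ≤ b := by exact_mod_cast h j
      have : (0:ℝ) ≤ ω' j := by positivity
      linarith
  have hle := le_hasSum hφ i (fun j _ => hnn j)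
  refine le_trans ?_ hle
  simp only [ψ]
  rw [if_neg (by omega), if_neg (by omega), ← sub_div, ← add_div]
  apply div_le_div_of_nonneg_right _ (by positivity)
  have h1 : (ω i : ℝ) + 2 ≤ b := by
    have := h i
    have : ω i + 2 ≤ b := by omega
    exact_mod_cast this
  have : (0:ℝ) ≤ ω' i := by positivity
  linarith

theorem totally_of_allowed (A : Finset ℕ) [Inhabited A] (hk : 3 ≤ A.card) (ω : ℕ → A)
    (h : ∀ i, ω i ∈ EE i ω) : TotallyDeBruijn A (fun i => (ω i : ℕ)) := by
  classical
  have hcard : Fintype.card A = A.card := Fintype.card_coe A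
  intro n hn v hv
  have hinj := allowed_inj (by rw [hcard]; exact hk) ω h n
  rw [hcard] at hinj
  have hp : 0 < A.card ^ n := Nat.pow_pos (by omega)
  let v' : Fin n → A := fun i => ⟨v i, hv i i.2⟩
  have himg : (Finset.range (A.card ^ n)).image (fun j => win n j ω) = Finset.univ := by
    apply Finset.eq_univ_of_card
    rw [Finset.card_image_of_injOn, Finset.card_range, Fintype.card_fun, Fintype.card_fin, hcard]
    intro i hi j hj hij
    simp only [Finset.coe_range, Set.mem_Iio] at hi hj
    exact hinj i hi j hj hij
  have hm : v' ∈ (Finset.range (A.card ^ n)).image (fun j => win n j ω) := by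
    rw [himg]; exact Finset.mem_univ _
  obtain ⟨j, hj, hjv⟩ := Finset.mem_image.1 hm
  rw [Finset.mem_range] at hj
  refine ⟨j, ⟨by omega, ?_⟩, ?_⟩
  · intro i hi
    have := congrFun hjv ⟨i, hi⟩
    simp only [win, v'] at this
    simp [this]
  · rintro j' ⟨h1, h2⟩
    apply hinj j' (by omega) j hj
    rw [hjv]
    funext i
    apply Subtype.ext
    exact h2 i i.2

theorem dist_lower (b : ℕ) (hb : 2 ≤ b) (A : Finset ℕ) [Inhabited A] (hAb : A ⊆ Finset.range b)
    (hk : 3 ≤ A.card) (ω ω' : ℕ → A)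
    (h : ∀ i, ω i ∈ EE i ω) (L : ℕ) (hag : ∀ i < L, ω i = ω' i)
    (hL : (ω L : ℕ) < ω' L) :
    1 / (b:ℝ) ^ (L + stg A.card L + 4)
      ≤ baseVal b (fun i => (ω' i : ℕ)) - baseVal b (fun i => (ω i : ℕ)) := by
  have hcard : Fintype.card A = A.card := Fintype.card_coe A
  have hlt : ∀ a : A, (a : ℕ) < b := fun a => Finset.mem_range.1 (hAb a.2)
  have hb' : (2:ℝ) ≤ b := by exact_mod_cast hb
  have hst := stg_lt A.card L (by omega)
  set n := stg A.card L with hn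
  have hinj := allowed_inj (by rw [hcard]; exact hk) ω h (n+2)
  rw [hcard] at hinj
  have hpow : L + 2 < A.card ^ (n+2) := by
    unfold startPos at hst
    have h1 : n + 1 < A.card ^ (n+1) := Nat.lt_pow_self (by omega)
    have h2 : A.card ^ (n+2) = A.card ^ (n+1) * A.card := pow_succ _ _
    have h3 : A.card ^ (n+1) * 3 ≤ A.card ^ (n+1) * A.card := Nat.mul_le_mul_left _ hk
    omega
  obtain ⟨i, hi1, hi2, hi3⟩ : ∃ i, L < i ∧ i ≤ L + n + 3 ∧ (ω i : ℕ) ≠ b - 1 := by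
    by_contra hcon
    push Not at hcon
    have := hinj (L+1) (by omega) (L+2) (by omega) (by
      funext i
      have := i.2
      apply Subtype.ext
      simp only [win]
      rw [hcon _ (by omega) (by omega), hcon _ (by omega) (by omega)])
    omega
  have hsep := base_sep b hb (fun i => (ω i : ℕ)) (fun i => (ω' i : ℕ)) (fun i => hlt _)
    (fun i => hlt _) L (fun i hi => by rw [hag i hi]) hL i hi1 hi3
  refine le_trans ?_ hsep
  apply one_div_le_one_div_of_le (by positivity)
  exact pow_le_pow_right₀ (by linarith) (by omega)

theorem pow_lower (k n : ℕ) (hk : 4 ≤ k) : 2 * k * n ≤ k ^ n + 2 * k := by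
  match n with
  | 0 => simp
  | 1 => simp
  | m + 2 =>
    have h1 : m < k ^ m := Nat.lt_pow_self (by omega)
    have h2 : k ^ (m+2) = k * (k * k ^ m) := by ring
    have h3 : 4 * k ^ m ≤ k * k ^ m := Nat.mul_le_mul_right _ hk
    have h4 : k * (2 * (m + 1)) ≤ k * (k * k ^ m) := Nat.mul_le_mul_left _ (by omega)
    rw [h2]
    linarith

theorem prod_lower (A : Finset ℕ) [Inhabited A] (hk : 3 ≤ A.card) (ω : ℕ → A)
    (h : ∀ i, ω i ∈ EE i ω) (L : ℕ) :
    Real.exp (Real.log (Nat.factorial (A.card - 2)) / (A.card - 1) *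
        ((L : ℝ) - stg A.card L - 1)) ≤ ∏ i ∈ Finset.range L, ((EE i ω).card : ℝ) := by
  have hcard : Fintype.card A = A.card := Fintype.card_coe A
  have hg := growth (by rw [hcard]; exact hk) ω h L
  rw [hcard] at hg
  have hpos : ∀ i, (0:ℝ) < (EE i ω).card := by
    intro i
    have : (EE i ω).Nonempty := ⟨_, h i⟩
    exact_mod_cast this.card_pos
  rw [← Real.log_prod (fun i _ => (hpos i).ne')] at hg
  rw [← Real.le_log_iff_exp_le (Finset.prod_pos (fun i _ => hpos i))]
  exact hg

theorem holder_bound (b : ℕ) (hb : 2 ≤ b) (A : Finset ℕ) [Inhabited A] (hAb : A ⊆ Finset.range b)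
    (hk : 4 ≤ A.card) (Ω : ℝ → ℕ → A)
    (hΩ : ∀ t ∈ Set.Ico (0:ℝ) 1, ∀ L, Ω t L ∈ EE L (Ω t))
    (hd : ∀ t ∈ Set.Ico (0:ℝ) 1, ∀ t' ∈ Set.Ico (0:ℝ) 1, ∀ L, (∀ i < L, Ω t i = Ω t' i) →
        |t - t'| * ∏ i ∈ Finset.range L, ((EE i (Ω t)).card : ℝ) ≤ 1)
    (c : ℝ) (hc : c = Real.log (Nat.factorial (A.card - 2))) (hcpos : 0 < c)
    (t : ℝ) (ht : t ∈ Set.Ico (0:ℝ) 1) (t' : ℝ) (ht' : t' ∈ Set.Ico (0:ℝ) 1) :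
    |t - t'| ≤ Real.exp (7 * c / (A.card - 1)) *
      |baseVal b (fun i => (Ω t i : ℕ)) - baseVal b (fun i => (Ω t' i : ℕ))|
        ^ (c / (A.card * Real.log b)) := by
  have hk' : (4:ℝ) ≤ A.card := by exact_mod_cast hk
  have hb' : (2:ℝ) ≤ b := by exact_mod_cast hb
  have hlogb : 0 < Real.log b := Real.log_pos (by linarith)
  have hk1 : (0:ℝ) < A.card - 1 := by linarith
  have hmain : ∀ L, (∀ i < L, Ω t i = Ω t' i) →
      |t - t'| * Real.exp (c / (A.card - 1) * ((L : ℝ) - stg A.card L - 1)) ≤ 1 := by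
    intro L hag
    refine le_trans ?_ (hd t ht t' ht' L hag)
    rw [hc]
    exact mul_le_mul_of_nonneg_left (prod_lower A (by omega) _ (hΩ t ht) L) (abs_nonneg _)
  by_cases heq : ∀ i, Ω t i = Ω t' i
  · have h0 : |t - t'| = 0 := by
      by_contra hne
      have hpos : 0 < |t - t'| := lt_of_le_of_ne (abs_nonneg _) (Ne.symm hne)
      obtain ⟨n, hn⟩ := exists_nat_gt (1 / (|t - t'| * (c / (A.card - 1))) + 2)
      have h1 := hmain (startPos A.card n) (fun i _ => heq i)
      rw [stg_eq A.card _ n (by omega) le_rfl (startPos_lt _ (by omega) _)] at h1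
      have h2 : (n:ℝ) ≤ (startPos A.card n : ℝ) - n + 1 := by
        have h3 : n < A.card ^ n := Nat.lt_pow_self (by omega)
        have : n + n ≤ startPos A.card n + 1 := by unfold startPos; omega
        have : (n:ℝ) + n ≤ startPos A.card n + 1 := by exact_mod_cast this
        linarith
      have hκ : 0 < c / (A.card - 1 : ℝ) := by positivity
      have h3 : c / (A.card - 1 : ℝ) * (n - 2) < Real.exp (c / (A.card - 1) *
          ((startPos A.card n : ℝ) - n - 1)) := by
        refine lt_of_le_of_lt ?_ (lt_of_lt_of_le (lt_add_one _) (Real.add_one_le_exp _))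
        apply mul_le_mul_of_nonneg_left _ hκ.le
        linarith
      have h4 : 1 / (|t - t'| * (c / (A.card - 1))) < n - 2 := by linarith
      rw [div_lt_iff₀ (by positivity)] at h4
      have h5 := mul_lt_mul_of_pos_left h3 hpos
      linarith
    rw [h0]
    positivity
  · push Not at heq
    classical
    let L := Nat.find heq
    have hL : Ω t L ≠ Ω t' L := Nat.find_spec heq
    have hag : ∀ i < L, Ω t i = Ω t' i := fun i hi => not_not.1 (Nat.find_min heq hi)
    clear_value L
    have hx : 1 / (b:ℝ) ^ (L + stg A.card L + 4)
        ≤ |baseVal b (fun i => (Ω t i : ℕ)) - baseVal b (fun i => (Ω t' i : ℕ))| := by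
      rcases lt_or_gt_of_ne (fun h => hL (Subtype.ext h) : (Ω t L : ℕ) ≠ Ω t' L) with hlt | hlt
      · rw [abs_sub_comm]
        exact (dist_lower b hb A hAb (by omega) _ _ (hΩ t ht) L hag hlt).trans (le_abs_self _)
      · exact (dist_lower b hb A hAb (by omega) _ _ (hΩ t' ht') L
          (fun i hi => (hag i hi).symm) hlt).trans (le_abs_self _)
    have hs : 0 ≤ c / (A.card * Real.log b) := by positivity
    have hxs := Real.rpow_le_rpow (by positivity) hx hs
    have hval : (1 / (b:ℝ) ^ (L + stg A.card L + 4)) ^ (c / (A.card * Real.log b))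
        = Real.exp (-(c / A.card * (L + stg A.card L + 4))) := by
      rw [Real.rpow_def_of_pos (by positivity), one_div, Real.log_inv, Real.log_pow]
      congr 1
      push_cast
      field_simp
    rw [hval] at hxs
    refine le_trans ?_ (mul_le_mul_of_nonneg_left hxs (Real.exp_pos _).le)
    rw [← Real.exp_add]
    have h1 := hmain L hag
    rw [← le_div_iff₀ (Real.exp_pos _), one_div, ← Real.exp_neg] at h1
    refine h1.trans (Real.exp_le_exp.2 ?_)
    have hst := stg_le A.card L
    have hpw := pow_lower A.card (stg A.card L) hk
    generalize stg A.card L = n at *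
    have hLn : 2 * A.card * n + n ≤ L + 2 * A.card + 1 := by
      unfold startPos at hst
      omega
    have hLn' : 2 * (A.card:ℝ) * n + n ≤ L + 2 * A.card + 1 := by exact_mod_cast hLn
    generalize (A.card : ℝ) = K at *
    have hn0 : (0:ℝ) ≤ n := by positivity
    have hkey : (K - 1) * ((L:ℝ) + n + 4) ≤ K * (L - n - 1) + 7 * K := by nlinarith
    have hmul := mul_le_mul_of_nonneg_left hkey (by positivity : 0 ≤ c / (K * (K - 1)))
    have e1 : c / (K * (K - 1)) * ((K - 1) * ((L:ℝ) + n + 4)) = c / K * (L + n + 4) := by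
      field_simp
    have e2 : c / (K * (K - 1)) * (K * (L - n - 1) + 7 * K)
        = c / (K - 1) * (L - n - 1) + 7 * c / (K - 1) := by
      field_simp
    rw [e1, e2] at hmul
    linarith

/-- Theorem (lower bound, `k ≥ 4`): the set `S` of points of `F` with a totally de Bruijn
base-`b` expansion has Hausdorff dimension at least `α_k·δ > 0`,
where `α_k = log((k-2)!)/(k log k)` and `δ = log k / log b = dim_H F`. -/
theorem statement2 (b : ℕ) (hb : 2 ≤ b) (A : Finset ℕ) (hAb : A ⊆ Finset.range b)
    (k : ℕ) (hk : k = A.card) (hk4 : 4 ≤ k)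
    (δ : ℝ) (hδ : δ = Real.log k / Real.log b)
    (α : ℝ) (hα : α = Real.log (Nat.factorial (k - 2)) / (k * Real.log k))
    (S : Set ℝ)
    (hS : S = {x : ℝ | ∃ ω : ℕ → ℕ, (∀ i, ω i ∈ A) ∧ TotallyDeBruijn A ω ∧
      x = baseVal b ω}) :
    ENNReal.ofReal (α * δ) ≤ dimH S ∧ 0 < α * δ := by
  subst hk
  have hk' : (4:ℝ) ≤ A.card := by exact_mod_cast hk4
  have hb' : (2:ℝ) ≤ b := by exact_mod_cast hb
  have hlogb : 0 < Real.log b := Real.log_pos (by linarith)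
  have hlogk : 0 < Real.log A.card := Real.log_pos (by linarith)
  obtain ⟨c, hc⟩ : ∃ c, c = Real.log (Nat.factorial (A.card - 2)) := ⟨_, rfl⟩
  have hcpos : 0 < c := by
    rw [hc]
    apply Real.log_pos
    have h1 : 2 ≤ A.card - 2 := by omega
    have h2 := Nat.self_le_factorial (A.card - 2)
    have : 1 < Nat.factorial (A.card - 2) := by omega
    exact_mod_cast this
  have hprod : α * δ = c / (A.card * Real.log b) := by
    rw [hα, hδ, ← hc]
    field_simp
  have hpos : 0 < c / (A.card * Real.log b) := by positivity
  rw [hprod]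
  refine ⟨?_, hpos⟩
  have hne : A.Nonempty := Finset.card_pos.1 (by omega)
  obtain ⟨a0, ha0⟩ := hne
  have : Inhabited A := ⟨⟨a0, ha0⟩⟩
  have hcard : Fintype.card A = A.card := Fintype.card_coe A
  obtain ⟨Ω, hΩ, hd⟩ := coding (α := A) EE EE_congr
    (fun L ω h => EE_nonempty (by rw [hcard]; omega) ω L h)
  have hdim := dim_lower (fun t => baseVal b (fun i => (Ω t i : ℕ)))
    (Real.toNNReal (Real.exp (7 * c / (A.card - 1))))
    (Real.toNNReal (c / (A.card * Real.log b))) (Real.toNNReal_pos.2 hpos) (by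
      intro t ht t' ht'
      rw [Real.coe_toNNReal _ (Real.exp_pos _).le, Real.coe_toNNReal _ hpos.le]
      exact holder_bound b hb A hAb hk4 Ω hΩ hd c hc hcpos t ht t' ht')
  refine le_trans hdim (dimH_mono ?_)
  rintro _ ⟨t, ht, rfl⟩
  rw [hS]
  exact ⟨fun i => (Ω t i : ℕ), fun i => (Ω t i).2,
    totally_of_allowed A (by omega) (Ω t) (hΩ t ht), rfl⟩
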